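/- arXiv:1809.02692 — 2 statements merged into one kernel-verified Lean document; each statement's English description precedes it below -/
import Mathlib

section
/- Let G = ⟨a,b,c ∣ aba⁻¹b⁻¹⟩ (the free product ℤ² * ℤ presented on generators a, b, c with the single relator [a,b]) and let Σ be the six-letter alphabet consisting of the images in G of a, b, c and their inverses. Let g_n be the number of geodesic words of length n over Σ. Then g₀ = 1, g₁ = 6, g₂ = 30, g₃ = 142, and g_n = 4·g_{n−1} + 3·g_{n−2} + 2·g_{n−3} for all n ≥ 4. Equivalently, the generating function ∑ g_n tⁿ equals (2t³ + 3t² + 2t + 1)/(1 − 4t − 3t² − 2t³). -/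
/-! The group `G = ⟨a,b,c ∣ aba⁻¹b⁻¹⟩ ≅ ℤ² * ℤ`, its six-letter alphabet of
generators and inverses, word length, and geodesic words. -/

/-- The single relator `[a,b] = a b a⁻¹ b⁻¹` in the free group on `a,b,c`. -/
def theRels : Set (FreeGroup (Fin 3)) :=
  {FreeGroup.of 0 * FreeGroup.of 1 * (FreeGroup.of 0)⁻¹ * (FreeGroup.of 1)⁻¹}

/-- The group `G = ⟨a,b,c ∣ aba⁻¹b⁻¹⟩`. -/
abbrev Gp : Type := PresentedGroup theRels

/-- The six-letter alphabet `Σ ⊆ G`: the images of `a, b, c` and their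
inverses. -/
def letters : Set Gp :=
  {x | ∃ i : Fin 3, x = PresentedGroup.of i ∨ x = (PresentedGroup.of i)⁻¹}

/-- The word length `|g|`: the minimum length of a list over `Σ` whose product
is `g`. -/
noncomputable def wl (g : Gp) : ℕ :=
  sInf {n | ∃ l : List Gp, (∀ x ∈ l, x ∈ letters) ∧ l.prod = g ∧ l.length = n}

/-- A word over `Σ` is geodesic if the word length of its product equals its
length. -/
def IsGeodesicWord (w : List Gp) : Prop :=
  (∀ x ∈ w, x ∈ letters) ∧ wl w.prod = w.length

/-- The sub-alphabet `{a, a⁻¹, b, b⁻¹}`. -/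
def abLetters : Set Gp :=
  {x | ∃ i : Fin 2, x = PresentedGroup.of (Fin.castSucc i) ∨
    x = (PresentedGroup.of (Fin.castSucc i))⁻¹}

/-- The sub-alphabet `{c, c⁻¹}`. -/
def cLetters : Set Gp :=
  {x | x = PresentedGroup.of (2 : Fin 3) ∨ x = (PresentedGroup.of (2 : Fin 3))⁻¹}

namespace GeoGrowth

/-- Raw normal forms `v₀ c^{e₁} v₁ c^{e₂} v₂ ⋯`. -/
abbrev Y : Type := (ℤ × ℤ) × List (Bool × (ℤ × ℤ))

/-- Labels of the six letters. -/
abbrev Lt : Type := Fin 3 × Bool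

def sg : Bool → ℤ
  | true => 1
  | false => -1

/-- Left multiplication by `c^{±1}`. -/
def cAct (e : Bool) : Y → Y
  | (h, []) => ((0, 0), [(e, h)])
  | (h, (e', v) :: L) =>
    if (h.1 = 0 ∧ h.2 = 0) ∧ e' = !e then (v, L) else ((0, 0), (e, h) :: (e', v) :: L)

/-- Left multiplication by a letter. -/
def actR : Lt → Y → Y
  | (0, e), y => ((y.1.1 + sg e, y.1.2), y.2)
  | (1, e), y => ((y.1.1, y.1.2 + sg e), y.2)
  | (2, e), y => cAct e y

def Red (y : Y) : Prop :=
  y.2.IsChain (fun p q => (p.2.1 = 0 ∧ p.2.2 = 0) → p.1 = q.1)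

def lenL : List (Bool × (ℤ × ℤ)) → ℕ
  | [] => 0
  | p :: L => 1 + p.2.1.natAbs + p.2.2.natAbs + lenL L

def len (y : Y) : ℕ := y.1.1.natAbs + y.1.2.natAbs + lenL y.2

theorem red_act (s : Lt) (y : Y) (hy : Red y) : Red (actR s y) := by
  obtain ⟨i, e⟩ := s
  obtain ⟨⟨h1, h2⟩, L⟩ := y
  fin_cases i
  · exact hy
  · exact hy
  · rcases L with _ | ⟨⟨e', v⟩, L⟩
    · simp [Red, actR, cAct]
    · simp only [Red, actR, cAct] at *
      split_ifs with hh
      · exact hy.tail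
      · refine List.IsChain.cons_cons ?_ hy
        intro h0
        simp only at h0
        cases e <;> cases e' <;> simp_all

theorem act_inv (i : Fin 3) (e : Bool) (y : Y) (hy : Red y) :
    actR (i, !e) (actR (i, e) y) = y := by
  obtain ⟨⟨h1, h2⟩, L⟩ := y
  fin_cases i
  · cases e <;> simp [actR, sg]
  · cases e <;> simp [actR, sg]
  · rcases L with _ | ⟨⟨e', v⟩, L⟩
    · simp [actR, cAct]
    · simp only [Red, actR, cAct] at *
      split_ifs with hh
      · obtain ⟨⟨h1, h2⟩, he⟩ := hh
        subst h1 h2 he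
        rcases L with _ | ⟨⟨e'', v'⟩, L⟩
        · simp [cAct]
        · simp only [cAct, Bool.not_not]
          have := List.isChain_cons_cons.1 hy
          rw [if_neg]
          rintro ⟨h0, h1⟩
          have := this.1 h0
          cases e <;> simp_all
      · simp [cAct]

abbrev X : Type := {y : Y // Red y}

def x0 : X := ⟨((0, 0), []), by simp [Red]⟩

def permL (i : Fin 3) : Equiv.Perm X where
  toFun x := ⟨actR (i, true) x.1, red_act _ _ x.2⟩
  invFun x := ⟨actR (i, false) x.1, red_act _ _ x.2⟩
  left_inv x := Subtype.ext (act_inv i true x.1 x.2)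
  right_inv x := Subtype.ext (act_inv i false x.1 x.2)

theorem rels_ok : ∀ r ∈ theRels, FreeGroup.lift permL r = 1 := by
  intro r hr
  rw [theRels, Set.mem_singleton_iff] at hr
  subst hr
  simp only [map_mul, map_inv, FreeGroup.lift_apply_of]
  have : permL 0 * permL 1 = permL 1 * permL 0 := by
    refine Equiv.ext fun x => ?_
    rfl
  rw [this]; group

def toPerm : Gp →* Equiv.Perm X := PresentedGroup.toGroup rels_ok

/-- The value of a letter. -/
def lv (s : Lt) : Gp := if s.2 then PresentedGroup.of s.1 else (PresentedGroup.of s.1)⁻¹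

theorem toPerm_lv (s : Lt) (x : X) : (toPerm (lv s) x).1 = actR s x.1 := by
  obtain ⟨i, e⟩ := s
  cases e
  · simp only [lv, toPerm, Bool.false_eq_true, if_false, map_inv, PresentedGroup.toGroup.of]
    rfl
  · simp only [lv, toPerm, if_true, PresentedGroup.toGroup.of]
    rfl

theorem lv_inj : Function.Injective lv := by
  intro s t h
  have h1 := toPerm_lv s x0
  rw [h, toPerm_lv] at h1
  obtain ⟨i, e⟩ := s
  obtain ⟨j, f⟩ := t
  fin_cases i <;> fin_cases j <;> cases e <;> cases f <;>
    simp [actR, cAct, x0, sg] at h1 ⊢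

theorem mem_letters (g : Gp) : g ∈ letters ↔ ∃ s, lv s = g := by
  constructor
  · rintro ⟨i, h | h⟩
    · exact ⟨(i, true), by simp [lv, h]⟩
    · exact ⟨(i, false), by simp [lv, h]⟩
  · rintro ⟨⟨i, e⟩, rfl⟩
    refine ⟨i, ?_⟩
    cases e
    · right; simp [lv]
    · left; simp [lv]

def ga : Gp := PresentedGroup.of 0
def gb : Gp := PresentedGroup.of 1
def gc : Gp := PresentedGroup.of 2

theorem comm_ab : ga * gb = gb * ga := by
  have h : (PresentedGroup.mk theRels) (FreeGroup.of 0 * FreeGroup.of 1 * (FreeGroup.of 0)⁻¹ * (FreeGroup.of 1)⁻¹) = 1 :=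
    PresentedGroup.one_of_mem (by simp [theRels])
  simp only [map_mul, map_inv] at h
  have h2 : ga * gb * ga⁻¹ * gb⁻¹ = 1 := h
  rw [mul_inv_eq_one, mul_inv_eq_iff_eq_mul] at h2
  exact h2

def valL : List (Bool × (ℤ × ℤ)) → Gp
  | [] => 1
  | p :: L => gc ^ sg p.1 * (ga ^ p.2.1 * gb ^ p.2.2 * valL L)

def val (y : Y) : Gp := ga ^ y.1.1 * gb ^ y.1.2 * valL y.2

theorem lv_eq (s : Lt) : lv s = (PresentedGroup.of s.1 : Gp) ^ sg s.2 := by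
  obtain ⟨i, e⟩ := s
  cases e <;> simp [lv, sg]

theorem val_act (s : Lt) (y : Y) : val (actR s y) = lv s * val y := by
  rw [lv_eq]
  obtain ⟨i, e⟩ := s
  obtain ⟨⟨h1, h2⟩, L⟩ := y
  fin_cases i
  · show ga ^ (h1 + sg e) * gb ^ h2 * valL L = ga ^ sg e * (ga ^ h1 * gb ^ h2 * valL L)
    rw [add_comm, zpow_add]; group
  · show ga ^ h1 * gb ^ (h2 + sg e) * valL L = gb ^ sg e * (ga ^ h1 * gb ^ h2 * valL L)
    have hc : Commute (ga ^ h1) (gb ^ sg e) := Commute.zpow_zpow comm_ab _ _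
    rw [add_comm, zpow_add, ← mul_assoc, ← mul_assoc, hc.eq]
    simp only [mul_assoc]
  · show val (cAct e ((h1, h2), L)) = gc ^ sg e * val ((h1, h2), L)
    rcases L with _ | ⟨⟨e', v⟩, L⟩
    · simp [cAct, val, valL]
    · simp only [cAct]
      split_ifs with hh
      · obtain ⟨⟨h1, h2⟩, he⟩ := hh
        subst h1 h2 he
        cases e <;> simp [val, valL, sg]
      · simp [val, valL]

def Rep (g : Gp) (n : ℕ) : Prop :=
  ∃ l : List Gp, (∀ x ∈ l, x ∈ letters) ∧ l.prod = g ∧ l.length = n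

theorem Rep.mul {g h : Gp} {m n : ℕ} (hg : Rep g m) (hh : Rep h n) : Rep (g * h) (m + n) := by
  obtain ⟨l, h1, h2, h3⟩ := hg
  obtain ⟨k, k1, k2, k3⟩ := hh
  refine ⟨l ++ k, ?_, by simp [h2, k2], by simp [h3, k3]⟩
  intro x hx
  rcases List.mem_append.1 hx with h | h
  · exact h1 x h
  · exact k1 x h

theorem rep_zpow (i : Fin 3) (k : ℤ) : Rep ((PresentedGroup.of i : Gp) ^ k) k.natAbs := by
  obtain ⟨n, rfl | rfl⟩ := k.eq_nat_or_neg
  · refine ⟨List.replicate n (PresentedGroup.of i), ?_, by simp, by simp⟩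
    intro x hx
    rw [List.eq_of_mem_replicate hx]
    exact ⟨i, Or.inl rfl⟩
  · refine ⟨List.replicate n (PresentedGroup.of i)⁻¹, ?_, by simp, by simp⟩
    intro x hx
    rw [List.eq_of_mem_replicate hx]
    exact ⟨i, Or.inr rfl⟩

theorem rep_valL (L : List (Bool × (ℤ × ℤ))) : Rep (valL L) (lenL L) := by
  induction L with
  | nil => exact ⟨[], by simp, rfl, rfl⟩
  | cons p L ih =>
    have h1 : Rep (gc ^ sg p.1) 1 := by
      have := rep_zpow 2 (sg p.1)
      cases hp : p.1 <;> rw [hp] at this <;> exact this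
    have := h1.mul (((rep_zpow 0 p.2.1).mul (rep_zpow 1 p.2.2)).mul ih)
    have e : lenL (p :: L) = 1 + (p.2.1.natAbs + p.2.2.natAbs + lenL L) := by
      simp only [lenL]; omega
    rw [e]; exact this

theorem rep_val (y : Y) : Rep (val y) (len y) :=
  ((rep_zpow 0 y.1.1).mul (rep_zpow 1 y.1.2)).mul (rep_valL y.2)

/-- Product of a label word. -/
def pr (w : List Lt) : Gp := (w.map lv).prod

/-- Normal form of a label word. -/
def nf : List Lt → Y
  | [] => ((0, 0), [])
  | s :: w => actR s (nf w)

theorem toPerm_pr (w : List Lt) : (toPerm (pr w) x0).1 = nf w := by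
  induction w with
  | nil => simp [pr, nf, x0]
  | cons s w ih =>
    have : pr (s :: w) = lv s * pr w := by simp [pr]
    rw [this, map_mul, Equiv.Perm.mul_apply, toPerm_lv, ih]; rfl

theorem val_nf (w : List Lt) : val (nf w) = pr w := by
  induction w with
  | nil => simp [nf, pr, val, valL]
  | cons s w ih =>
    have : pr (s :: w) = lv s * pr w := by simp [pr]
    rw [this, ← ih, ← val_act]; rfl

theorem len_act_le (s : Lt) (y : Y) : len (actR s y) ≤ len y + 1 := by
  obtain ⟨i, e⟩ := s
  obtain ⟨⟨h1, h2⟩, L⟩ := y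
  fin_cases i
  · cases e <;> simp [actR, len, sg] <;> omega
  · cases e <;> simp [actR, len, sg] <;> omega
  · rcases L with _ | ⟨⟨e', v⟩, L⟩
    · simp [actR, cAct, len, lenL]; omega
    · simp only [actR, cAct]
      split_ifs <;> simp [len, lenL] <;> omega

theorem len_nf_le (w : List Lt) : len (nf w) ≤ w.length := by
  induction w with
  | nil => simp [nf, len, lenL]
  | cons s w ih =>
    have := len_act_le s (nf w)
    simp only [nf, List.length_cons]; omega

theorem exists_labels (l : List Gp) (h : ∀ x ∈ l, x ∈ letters) :
    ∃ w : List Lt, w.map lv = l := by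
  induction l with
  | nil => exact ⟨[], rfl⟩
  | cons x l ih =>
    obtain ⟨w, hw⟩ := ih (fun y hy => h y (List.mem_cons_of_mem _ hy))
    obtain ⟨s, hs⟩ := (mem_letters x).1 (h x List.mem_cons_self)
    exact ⟨s :: w, by simp [hs, hw]⟩

theorem wl_pr (w : List Lt) : wl (pr w) = len (nf w) := by
  apply le_antisymm
  · apply Nat.sInf_le
    have := rep_val (nf w)
    rw [val_nf] at this
    exact this
  · refine le_csInf ⟨len (nf w), ?_⟩ ?_
    · have := rep_val (nf w)
      rw [val_nf] at this
      exact this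
    · rintro n ⟨l, h1, h2, rfl⟩
      obtain ⟨u, rfl⟩ := exists_labels l h1
      have h3 : pr u = pr w := h2
      rw [← toPerm_pr, ← h3, toPerm_pr, List.length_map]
      exact len_nf_le u

def consEmb : (List Lt × Lt) ↪ List Lt where
  toFun p := p.2 :: p.1
  inj' := by
    rintro ⟨a, b⟩ ⟨c, d⟩ h
    simp only [List.cons.injEq] at h
    simp [h]

/-- Geodesic label words of length `n`. -/
def G : ℕ → Finset (List Lt)
  | 0 => {[]}
  | n + 1 => ((G n ×ˢ (Finset.univ : Finset Lt)).filter
      (fun p => len (actR p.2 (nf p.1)) = len (nf p.1) + 1)).map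
      consEmb

theorem mem_G (n : ℕ) (w : List Lt) : w ∈ G n ↔ len (nf w) = n ∧ w.length = n := by
  induction n generalizing w with
  | zero =>
    simp only [G, Finset.mem_singleton, List.length_eq_zero_iff]
    constructor
    · rintro rfl; simp [nf, len, lenL]
    · exact fun h => h.2
  | succ n ih =>
    simp only [G, Finset.mem_map, Finset.mem_filter, Finset.mem_product, Finset.mem_univ,
      and_true]
    constructor
    · rintro ⟨⟨u, s⟩, ⟨h1, h2⟩, rfl⟩
      rw [ih] at h1
      show len (actR s (nf u)) = n + 1 ∧ u.length + 1 = n + 1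
      simp only at h1 h2
      omega
    · rintro ⟨h1, h2⟩
      rcases w with _ | ⟨s, u⟩
      · simp at h2
      · simp only [nf, List.length_cons] at h1 h2
        have := len_act_le s (nf u)
        have := len_nf_le u
        refine ⟨(u, s), ⟨(ih u).2 ⟨by omega, by omega⟩, ?_⟩, rfl⟩
        show len (actR s (nf u)) = len (nf u) + 1
        omega

theorem ncard_eq (n : ℕ) :
    Set.ncard {w : List Gp | IsGeodesicWord w ∧ w.length = n} = (G n).card := by
  have : {w : List Gp | IsGeodesicWord w ∧ w.length = n} = List.map lv '' (G n : Set (List Lt)) := by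
    ext w
    simp only [Set.mem_ofPred_eq, Set.mem_image, Finset.mem_coe, mem_G]
    constructor
    · rintro ⟨⟨h1, h2⟩, h3⟩
      obtain ⟨u, rfl⟩ := exists_labels w h1
      have := wl_pr u
      rw [List.length_map] at h2 h3
      exact ⟨u, ⟨by rw [← this, ← h3]; exact h2, h3⟩, rfl⟩
    · rintro ⟨u, ⟨h1, h2⟩, rfl⟩
      refine ⟨⟨?_, ?_⟩, by simpa using h2⟩
      · intro x hx
        obtain ⟨s, -, rfl⟩ := List.mem_map.1 hx
        exact (mem_letters _).2 ⟨s, rfl⟩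
      · have := wl_pr u
        rw [List.length_map, h2, ← h1]; exact this
  rw [this, Set.ncard_image_of_injective _ (List.map_injective_iff.2 lv_inj), Set.ncard_coe_finset]

/-- Cone type of a normal form. -/
def ty (y : Y) : Fin 4 :=
  if y.1.1 = 0 then
    if y.1.2 = 0 then (if y.2.isEmpty then 0 else 1) else 2
  else if y.1.2 = 0 then 2 else 3

/-- Number of geodesic words of a given type. -/
def N (n : ℕ) (t : Fin 4) : ℕ := ∑ w ∈ G n, if ty (nf w) = t then 1 else 0

def M : Fin 4 → Fin 4 → ℕ :=
  ![![0, 2, 4, 0], ![0, 1, 4, 0], ![0, 2, 1, 2], ![0, 2, 0, 2]]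

set_option maxHeartbeats 4000000 in
theorem step (y : Y) (t : Fin 4) :
    (∑ s : Lt, if len (actR s y) = len y + 1 then (if ty (actR s y) = t then 1 else 0) else 0)
      = M (ty y) t := by
  obtain ⟨⟨h1, h2⟩, L⟩ := y
  have a1 : (len (actR (0, true) ((h1, h2), L)) = len ((h1, h2), L) + 1) ↔ 0 ≤ h1 := by
    simp only [actR, len, sg]; omega
  have a2 : (len (actR (0, false) ((h1, h2), L)) = len ((h1, h2), L) + 1) ↔ h1 ≤ 0 := by
    simp only [actR, len, sg]; omega
  have a3 : (len (actR (1, true) ((h1, h2), L)) = len ((h1, h2), L) + 1) ↔ 0 ≤ h2 := by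
    simp only [actR, len, sg]; omega
  have a4 : (len (actR (1, false) ((h1, h2), L)) = len ((h1, h2), L) + 1) ↔ h2 ≤ 0 := by
    simp only [actR, len, sg]; omega
  have a5 : ∀ e, (len (actR (2, e) ((h1, h2), L)) = len ((h1, h2), L) + 1) ↔
      ¬ ((h1 = 0 ∧ h2 = 0) ∧ L.head?.map Prod.fst = some (!e)) := by
    intro e
    rcases L with _ | ⟨⟨e', v⟩, L⟩
    · simp [actR, cAct, len, lenL]; omega
    · simp only [actR, cAct, List.head?_cons, Option.map_some, Option.some.injEq]
      split_ifs with hh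
      · simp only [hh, len, lenL]; simp; omega
      · simp only [hh, len, lenL]; simp; omega
  have b5 : ∀ e, ¬ ((h1 = 0 ∧ h2 = 0) ∧ L.head?.map Prod.fst = some (!e)) →
      ty (actR (2, e) ((h1, h2), L)) = 1 := by
    intro e he
    rcases L with _ | ⟨⟨e', v⟩, L⟩
    · simp [actR, cAct, ty]
    · simp only [List.head?_cons, Option.map_some, Option.some.injEq] at he
      simp only [actR, cAct]
      rw [if_neg he]
      simp [ty]
  have c5 : ∀ e, (if len (actR (2, e) ((h1, h2), L)) = len ((h1, h2), L) + 1 then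
      (if ty (actR (2, e) ((h1, h2), L)) = t then 1 else 0) else 0) =
      if ((h1 = 0 ∧ h2 = 0) ∧ L.head?.map Prod.fst = some (!e)) then 0 else
        if 1 = t then 1 else 0 := by
    intro e
    rw [if_congr (a5 e) rfl rfl, ite_not]
    by_cases hh : ((h1 = 0 ∧ h2 = 0) ∧ L.head?.map Prod.fst = some (!e))
    · rw [if_pos hh, if_pos hh]
    · rw [if_neg hh, if_neg hh, b5 e hh]
  rw [Fintype.sum_prod_type, Fin.sum_univ_three]
  simp only [Fintype.sum_bool, c5, a1, a2, a3, a4]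
  simp only [actR, sg]
  have p1 : 0 ≤ h1 → ¬ h1 + 1 = 0 := by omega
  have p2 : h1 ≤ 0 → ¬ h1 + -1 = 0 := by omega
  have p3 : 0 ≤ h2 → ¬ h2 + 1 = 0 := by omega
  have p4 : h2 ≤ 0 → ¬ h2 + -1 = 0 := by omega
  have tri : ∀ z : ℤ, (z = 0) ∨ (¬ z = 0 ∧ 0 ≤ z ∧ ¬ z ≤ 0) ∨ (¬ z = 0 ∧ ¬ 0 ≤ z ∧ z ≤ 0) := by
    intro z; omega
  have t1 := tri h1
  have t2 := tri h2
  clear a1 a2 a3 a4 a5 b5 c5 tri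
  rcases t1 with q1 | ⟨q1, r1, s1⟩ | ⟨q1, r1, s1⟩ <;>
    rcases t2 with q2 | ⟨q2, r2, s2⟩ | ⟨q2, r2, s2⟩ <;>
    rcases L with _ | ⟨⟨e', v⟩, L⟩ <;>
    (try cases e') <;> fin_cases t <;>
    simp_all [ty, M] <;> (split_ifs <;> omega)

theorem N_succ (n : ℕ) (t : Fin 4) : N (n + 1) t = ∑ u, N n u * M u t := by
  have h : N (n + 1) t = ∑ w ∈ G n, M (ty (nf w)) t := by
    rw [N, G, Finset.sum_map, Finset.sum_filter, Finset.sum_product]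
    refine Finset.sum_congr rfl fun w _ => ?_
    rw [← step]
    rfl
  rw [h]
  simp only [N, Finset.sum_mul]
  rw [Finset.sum_comm]
  refine Finset.sum_congr rfl fun w _ => ?_
  simp

theorem card_G (n : ℕ) : (G n).card = N n 0 + N n 1 + N n 2 + N n 3 := by
  rw [← Fin.sum_univ_four]
  simp only [N]
  rw [Finset.sum_comm]
  simp

theorem rec0 (n : ℕ) : N (n + 1) 0 = 0 := by
  rw [N_succ, Fin.sum_univ_four]; simp [M]

theorem rec1 (n : ℕ) : N (n + 1) 1 = 2 * N n 0 + N n 1 + 2 * N n 2 + 2 * N n 3 := by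
  rw [N_succ, Fin.sum_univ_four]; simp [M]; ring

theorem rec2 (n : ℕ) : N (n + 1) 2 = 4 * N n 0 + 4 * N n 1 + N n 2 := by
  rw [N_succ, Fin.sum_univ_four]; simp [M]; ring

theorem rec3 (n : ℕ) : N (n + 1) 3 = 2 * N n 2 + 2 * N n 3 := by
  rw [N_succ, Fin.sum_univ_four]; simp [M]; ring

theorem base_counts (t : Fin 4) : N 0 t = if t = 0 then 1 else 0 := by
  rw [N, G, Finset.sum_singleton]
  fin_cases t <;> rfl

end GeoGrowth

/-- the number `g_n` of geodesic words of length `n` over the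
six-letter alphabet of `G = ⟨a,b,c ∣ aba⁻¹b⁻¹⟩` satisfies `g₀ = 1`, `g₁ = 6`,
`g₂ = 30`, `g₃ = 142`, and `g_n = 4 g_{n-1} + 3 g_{n-2} + 2 g_{n-3}` for
`n ≥ 4`. -/
theorem geodesic_growth_all (g : ℕ → ℕ)
    (hg : ∀ n, g n = Set.ncard {w : List Gp | IsGeodesicWord w ∧ w.length = n}) :
    g 0 = 1 ∧ g 1 = 6 ∧ g 2 = 30 ∧ g 3 = 142 ∧
      ∀ n, 4 ≤ n → g n = 4 * g (n - 1) + 3 * g (n - 2) + 2 * g (n - 3) := by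
  have hc : ∀ n, g n = GeoGrowth.N n 0 + GeoGrowth.N n 1 + GeoGrowth.N n 2 + GeoGrowth.N n 3 := by
    intro n
    rw [hg, GeoGrowth.ncard_eq, GeoGrowth.card_G]
  have i0 := GeoGrowth.base_counts 0
  have i1 := GeoGrowth.base_counts 1
  have i2 := GeoGrowth.base_counts 2
  have i3 := GeoGrowth.base_counts 3
  simp at i0 i1 i2 i3
  refine ⟨?_, ?_, ?_, ?_, ?_⟩
  · simp [hc, i0, i1, i2, i3]
  · simp [hc, GeoGrowth.rec0, GeoGrowth.rec1, GeoGrowth.rec2, GeoGrowth.rec3, i0, i1, i2, i3]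
  · simp [hc, GeoGrowth.rec0, GeoGrowth.rec1, GeoGrowth.rec2, GeoGrowth.rec3, i0, i1, i2, i3]
  · simp [hc, GeoGrowth.rec0, GeoGrowth.rec1, GeoGrowth.rec2, GeoGrowth.rec3, i0, i1, i2, i3]
  · intro n hn
    obtain ⟨k, rfl⟩ : ∃ k, n = k + 1 + 1 + 1 + 1 := ⟨n - 4, by omega⟩
    have e1 : k + 1 + 1 + 1 + 1 - 1 = k + 1 + 1 + 1 := by omega
    have e2 : k + 1 + 1 + 1 + 1 - 2 = k + 1 + 1 := by omega
    have e3 : k + 1 + 1 + 1 + 1 - 3 = k + 1 := by omega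
    rw [e1, e2, e3]
    simp only [hc, GeoGrowth.rec0, GeoGrowth.rec1, GeoGrowth.rec2, GeoGrowth.rec3]
    ring
end

section
/- Let G = ⟨a,b,c ∣ aba⁻¹b⁻¹⟩ (the free product ℤ² * ℤ presented on generators a, b, c with the single relator [a,b]) and let Σ be the six-letter alphabet consisting of the images in G of a, b, c and their inverses. Let k_n be the number of geodesic words of length n over Σ containing no three consecutive letters all belonging to {a, a⁻¹, b, b⁻¹}. Then k₀ = 1, k₁ = 6, k₂ = 30, k₃ = 114, and k_n = k_{n−1} + 8·k_{n−2} + 24·k_{n−3} for all n ≥ 4. Equivalently, the generating function ∑ k_n tⁿ equals (12t³ + 16t² + 5t + 1)/(1 − t − 8t² − 24t³). -/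
/-- `w` contains no three consecutive letters all in `{a, a⁻¹, b, b⁻¹}`. -/
def NoThreeConsecutiveAB (w : List Gp) : Prop :=
  ∀ k : ℕ, k + 2 < w.length →
    ¬(w.getD k 1 ∈ abLetters ∧ w.getD (k + 1) 1 ∈ abLetters ∧
      w.getD (k + 2) 1 ∈ abLetters)

section Helpers

open Monoid

/-- formal letters: generator index and sign. -/
abbrev Lt : Type := Fin 3 × Bool

def ev (x : Lt) : Gp := if x.2 then PresentedGroup.of x.1 else (PresentedGroup.of x.1)⁻¹

def flipL (x : Lt) : Lt := (x.1, !x.2)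

def isAB (x : Lt) : Bool := decide (x.1 ≠ 2)

def ok (x : Lt) : List Lt → Bool
  | [] => true
  | [y] => decide (y ≠ flipL x)
  | y :: z :: _ => decide (y ≠ flipL x) && !(isAB x && isAB y && isAB z)

def Good : List Lt → Prop
  | [] => True
  | x :: l => Good l ∧ ok x l = true

abbrev Zz : Type := Multiplicative (ℤ × ℤ)

abbrev Fam : Bool → Type := fun _ => Zz

def vecG (i : Fin 3) : ℤ × ℤ := if i = 1 then (0, 1) else (1, 0)

def vec (x : Lt) : ℤ × ℤ := if x.2 then vecG x.1 else -vecG x.1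

def idx (i : Fin 3) : Bool := decide (i = 2)

def genC (i : Fin 3) : CoprodI Fam :=
  CoprodI.of (M := Fam) (i := idx i) (Multiplicative.ofAdd (vecG i))

lemma genC_rel : ∀ r ∈ theRels, FreeGroup.lift genC r = 1 := by
  intro r hr
  simp only [theRels, Set.mem_singleton_iff] at hr
  subst hr
  simp only [map_mul, map_inv, FreeGroup.lift_apply_of]
  have h0 : genC 0 = CoprodI.of (M := Fam) (i := false) (Multiplicative.ofAdd (vecG 0)) := rfl
  have h1 : genC 1 = CoprodI.of (M := Fam) (i := false) (Multiplicative.ofAdd (vecG 1)) := rfl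
  rw [h0, h1, ← map_mul, mul_comm, map_mul]
  group

def toC : Gp →* CoprodI Fam := PresentedGroup.toGroup genC_rel

lemma toC_ev (x : Lt) : toC (ev x) =
    CoprodI.of (M := Fam) (i := idx x.1) (Multiplicative.ofAdd (vec x)) := by
  rcases x with ⟨i, s⟩
  cases s
  · have : toC (PresentedGroup.of i) = genC i := PresentedGroup.toGroup.of genC_rel
    simp only [ev, vec, Bool.false_eq_true, if_false, map_inv, this, genC, ofAdd_neg]
  · have : toC (PresentedGroup.of i) = genC i := PresentedGroup.toGroup.of genC_rel
    simp only [ev, vec, if_true, this, genC]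

def abG (i : Fin 3) : Multiplicative (Fin 3 → ℤ) := Multiplicative.ofAdd (Pi.single i 1)

lemma abG_rel : ∀ r ∈ theRels, FreeGroup.lift abG r = 1 := by
  intro r hr
  simp only [theRels, Set.mem_singleton_iff] at hr
  subst hr
  simp only [map_mul, map_inv, FreeGroup.lift_apply_of]
  rw [mul_comm (abG 0)]
  group

def toAb : Gp →* Multiplicative (Fin 3 → ℤ) := PresentedGroup.toGroup abG_rel

lemma toAb_ev (x : Lt) : toAb (ev x) = if x.2 then abG x.1 else (abG x.1)⁻¹ := by
  rcases x with ⟨i, s⟩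
  have : toAb (PresentedGroup.of i) = abG i := PresentedGroup.toGroup.of abG_rel
  cases s <;> simp [ev, this]

lemma abG_inj : ∀ x y : Lt, ((if x.2 then abG x.1 else (abG x.1)⁻¹) =
    if y.2 then abG y.1 else (abG y.1)⁻¹) → x = y := by
  have key : ∀ x y : Lt, ((if x.2 then (Pi.single x.1 1 : Fin 3 → ℤ) else -(Pi.single x.1 1)) =
    if y.2 then (Pi.single y.1 1) else -(Pi.single y.1 1)) → x = y := by decide
  intro x y h
  apply key
  have := congrArg Multiplicative.toAdd h
  rcases x with ⟨i, s⟩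
  rcases y with ⟨j, t⟩
  cases s <;> cases t <;> simpa [abG] using this

lemma ev_inj : Function.Injective ev := by
  intro x y h
  apply abG_inj
  rw [← toAb_ev, ← toAb_ev, h]

lemma ev_flip (x : Lt) : ev x * ev (flipL x) = 1 := by
  rcases x with ⟨i, s⟩
  cases s <;> simp [ev, flipL]

lemma mem_letters_iff (g : Gp) : g ∈ letters ↔ ∃ x, ev x = g := by
  constructor
  · rintro ⟨i, h | h⟩
    · exact ⟨(i, true), by simp [ev, h]⟩
    · exact ⟨(i, false), by simp [ev, h]⟩
  · rintro ⟨⟨i, s⟩, rfl⟩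
    refine ⟨i, ?_⟩
    cases s <;> simp [ev]

lemma mem_ab_iff (x : Lt) : ev x ∈ abLetters ↔ isAB x = true := by
  constructor
  · rintro ⟨i, h | h⟩
    · have : x = (i.castSucc, true) := ev_inj (by rw [h]; simp [ev])
      subst this
      clear h; revert i; decide
    · have : x = (i.castSucc, false) := ev_inj (by rw [h]; simp [ev])
      subst this
      clear h; revert i; decide
  · rcases x with ⟨i, s⟩
    intro h
    fin_cases i
    · refine ⟨0, ?_⟩
      cases s <;> simp [ev]
    · refine ⟨1, ?_⟩
      cases s <;> simp [ev]
    · simp [isAB] at h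

/-! ### length function -/

def nrm (v : ℤ × ℤ) : ℕ := v.1.natAbs + v.2.natAbs

lemma nrm_add (v w : ℤ × ℤ) : nrm (v + w) ≤ nrm v + nrm w := by
  simp only [nrm, Prod.fst_add, Prod.snd_add]; omega

lemma nrm_vec : ∀ x : Lt, nrm (vec x) = 1 := by decide

def wnorm (w : CoprodI.Word Fam) : ℕ :=
  (w.toList.map (fun s => nrm (Multiplicative.toAdd (s.2 : Zz)))).sum

def hd (i : Bool) (w : CoprodI.Word Fam) : ℤ × ℤ :=
  Multiplicative.toAdd ((CoprodI.Word.equivPair i w).head : Zz)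

def tlw (i : Bool) (w : CoprodI.Word Fam) : CoprodI.Word Fam :=
  (CoprodI.Word.equivPair i w).tail

lemma wnorm_rcons {i : Bool} (p : CoprodI.Word.Pair Fam i) :
    wnorm (CoprodI.Word.rcons p) = nrm (Multiplicative.toAdd (p.head : Zz)) + wnorm p.tail := by
  unfold CoprodI.Word.rcons
  split_ifs with h
  · rw [h]
    have : nrm (Multiplicative.toAdd (1 : Zz)) = 0 := rfl
    exact (by rw [this, zero_add] : wnorm p.tail = nrm (Multiplicative.toAdd (1 : Zz)) + wnorm p.tail)
  · simp [wnorm, CoprodI.Word.cons]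

lemma wnorm_eq (i : Bool) (w : CoprodI.Word Fam) : wnorm w = nrm (hd i w) + wnorm (tlw i w) := by
  have := wnorm_rcons (CoprodI.Word.equivPair i w)
  rw [← CoprodI.Word.equivPair_symm, Equiv.symm_apply_apply] at this
  exact this

lemma hd_smul (i : Bool) (v : ℤ × ℤ) (w : CoprodI.Word Fam) :
    hd i (CoprodI.of (M := Fam) (i := i) (Multiplicative.ofAdd v) • w) = v + hd i w := by
  unfold hd
  rw [CoprodI.Word.equivPair_smul_same]
  rfl

lemma tlw_smul (i : Bool) (v : ℤ × ℤ) (w : CoprodI.Word Fam) :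
    tlw i (CoprodI.of (M := Fam) (i := i) (Multiplicative.ofAdd v) • w) = tlw i w := by
  unfold tlw
  rw [CoprodI.Word.equivPair_smul_same]

lemma hd_other (i j : Bool) (hij : j ≠ i) (w : CoprodI.Word Fam) (h : hd i w ≠ 0) :
    hd j w = 0 := by
  have hw : CoprodI.Word.rcons (CoprodI.Word.equivPair i w) = w := by
    rw [← CoprodI.Word.equivPair_symm, Equiv.symm_apply_apply]
  have h1 : (CoprodI.Word.equivPair i w).head ≠ 1 := fun h' => h (by unfold hd; rw [h']; rfl)
  have hf : CoprodI.Word.fstIdx w = some i := by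
    rw [← hw]
    unfold CoprodI.Word.rcons
    rw [dif_neg h1]
    simp
  have hne : CoprodI.Word.fstIdx w ≠ some j := by
    rw [hf]; simpa using hij.symm
  unfold hd
  rw [CoprodI.Word.equivPair_eq_of_fstIdx_ne hne]
  rfl

def act (g : Gp) : CoprodI.Word Fam := toC g • CoprodI.Word.empty

lemma act_cons (x : Lt) (g : Gp) : act (ev x * g) =
    CoprodI.of (M := Fam) (i := idx x.1) (Multiplicative.ofAdd (vec x)) • act g := by
  unfold act
  rw [map_mul, mul_smul, toC_ev]

lemma act_one : act 1 = CoprodI.Word.empty := by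
  unfold act; rw [map_one, one_smul]

lemma wnorm_act_cons (x : Lt) (g : Gp) : wnorm (act (ev x * g)) =
    nrm (vec x + hd (idx x.1) (act g)) + wnorm (tlw (idx x.1) (act g)) := by
  rw [wnorm_eq (idx x.1), act_cons, hd_smul, tlw_smul]

lemma wnorm_le (l : List Gp) (hl : ∀ x ∈ l, x ∈ letters) : wnorm (act l.prod) ≤ l.length := by
  induction l with
  | nil => rw [List.prod_nil, act_one]; exact le_refl 0
  | cons g l ih =>
    obtain ⟨x, rfl⟩ := (mem_letters_iff g).1 (hl g (by simp))
    have := ih (fun y hy => hl y (by simp [hy]))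
    rw [List.prod_cons, wnorm_act_cons, List.length_cons]
    rw [wnorm_eq (idx x.1)] at this
    have h1 := nrm_add (vec x) (hd (idx x.1) (act l.prod))
    rw [nrm_vec] at h1
    omega

def ph (i : Bool) : List Lt → ℤ × ℤ
  | [] => 0
  | x :: l => if idx x.1 = i then vec x + ph i l else 0

lemma ph_c (s : Bool) (l : List Lt) (h : Good ((2, s) :: l)) :
    ∃ k : ℕ, ph true ((2, s) :: l) = ((if s then 1 else -1) * ((k : ℤ) + 1), 0) := by
  induction l with
  | nil => refine ⟨0, ?_⟩; clear h; revert s; decide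
  | cons y l ih =>
    rcases y with ⟨i, t⟩
    by_cases hi : i = 2
    · subst hi
      have hst : t = s := by
        have := h.2
        rcases l with _ | ⟨z, l⟩ <;> cases s <;> cases t <;> simp_all [ok, flipL]
      subst hst
      obtain ⟨k, hk⟩ := ih h.1
      refine ⟨k + 1, ?_⟩
      rw [ph, if_pos (by rfl), hk]
      cases t <;> simp [vec, vecG] <;> ring
    · refine ⟨0, ?_⟩
      have : ph true ((i, t) :: l) = 0 := by
        rw [ph, if_neg (by simp [idx, hi])]
      rw [ph, if_pos (by rfl), this]
      cases s <;> simp [vec, vecG]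

lemma nrm_pair : ∀ x y : Lt, isAB x = true → isAB y = true → y ≠ flipL x →
    nrm (vec x + vec y) = 2 := by decide

lemma nrm_step (x : Lt) (l : List Lt) (h : Good (x :: l)) :
    nrm (vec x + ph (idx x.1) l) = nrm (ph (idx x.1) l) + 1 := by
  rcases l with _ | ⟨y, l⟩
  · simp only [ph, add_zero]
    rw [nrm_vec]; rfl
  by_cases hxy : idx y.1 = idx x.1
  swap
  · rw [ph, if_neg hxy, add_zero, nrm_vec]; rfl
  rcases x with ⟨i, s⟩
  by_cases hi : i = 2
  · subst hi
    rcases y with ⟨j, t⟩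
    have hj : j = 2 := by simpa [idx] using hxy
    subst hj
    have hst : t = s := by
      have := h.2
      rcases l with _ | ⟨z, l⟩ <;> cases s <;> cases t <;> simp_all [ok, flipL]
    subst hst
    obtain ⟨k, hk⟩ := ph_c t l h.1
    have : idx (2 : Fin 3) = true := rfl
    simp only [this]
    rw [hk]
    cases t <;> simp [nrm, vec, vecG] <;> omega
  · have hx : isAB (i, s) = true := by simp [isAB, hi]
    have hidx : idx i = false := by simp [idx, hi]
    have hy : isAB y = true := by
      rw [hidx] at hxy
      have : ¬ y.1 = 2 := by simpa [idx] using hxy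
      simp [isAB, this]
    have hz : ph (idx i) l = 0 := by
      rcases l with _ | ⟨z, l⟩
      · rfl
      · have := h.2
        have hz : isAB z = false := by simp_all [ok]
        rw [ph, if_neg]
        rw [hidx]
        simpa [isAB, idx] using hz
    have hne : y ≠ flipL (i, s) := by
      have := h.2
      rcases l with _ | ⟨z, l⟩ <;> simp_all [ok]
    simp only [ph, hxy, if_true]
    rw [hz, add_zero, nrm_pair _ _ hx hy hne, nrm_vec]

lemma good_main (l : List Lt) (h : Good l) :
    (∀ i, hd i (act (l.map ev).prod) = ph i l) ∧ wnorm (act (l.map ev).prod) = l.length := by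
  induction l with
  | nil =>
    rw [List.map_nil, List.prod_nil, act_one]
    refine ⟨fun i => ?_, rfl⟩
    unfold hd
    rw [CoprodI.Word.equivPair_eq_of_fstIdx_ne (by simp [CoprodI.Word.fstIdx])]
    rfl
  | cons x l ih =>
    obtain ⟨h1, h2⟩ := ih h.1
    have hn := nrm_step x l h
    rw [List.map_cons, List.prod_cons]
    have hh : hd (idx x.1) (act (ev x * (l.map ev).prod)) = vec x + ph (idx x.1) l := by
      rw [act_cons, hd_smul, h1]
    constructor
    · intro j
      by_cases hj : idx x.1 = j
      · subst hj
        rw [hh, ph, if_pos rfl]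
      · rw [ph, if_neg hj]
        apply hd_other (idx x.1) j (Ne.symm hj)
        rw [hh]
        intro h0
        rw [h0] at hn
        have : nrm 0 = 0 := rfl
        omega
    · rw [wnorm_act_cons, h1, hn, List.length_cons]
      rw [wnorm_eq (idx x.1), h1] at h2
      omega

lemma wl_le (l : List Gp) (hl : ∀ x ∈ l, x ∈ letters) : wl l.prod ≤ l.length :=
  Nat.sInf_le ⟨l, hl, rfl, rfl⟩

lemma wl_spec (l : List Gp) (hl : ∀ x ∈ l, x ∈ letters) :
    ∃ l' : List Gp, (∀ x ∈ l', x ∈ letters) ∧ l'.prod = l.prod ∧ l'.length = wl l.prod :=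
  Nat.sInf_mem (s := {n | ∃ l' : List Gp, (∀ x ∈ l', x ∈ letters) ∧ l'.prod = l.prod ∧
    l'.length = n}) ⟨l.length, l, hl, rfl, rfl⟩

lemma map_letters (l : List Lt) : ∀ x ∈ l.map ev, x ∈ letters := by
  intro x hx
  obtain ⟨y, -, rfl⟩ := List.mem_map.1 hx
  exact (mem_letters_iff _).2 ⟨y, rfl⟩

lemma good_geodesic (l : List Lt) (h : Good l) : IsGeodesicWord (l.map ev) := by
  refine ⟨map_letters l, le_antisymm (wl_le _ (map_letters l)) ?_⟩
  obtain ⟨l', h1, h2, h3⟩ := wl_spec _ (map_letters l)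
  rw [← h3, List.length_map, ← (good_main l h).2, ← h2]
  exact wnorm_le l' h1

lemma good_noThree (l : List Lt) (h : Good l) : NoThreeConsecutiveAB (l.map ev) := by
  induction l with
  | nil => intro k hk; simp at hk
  | cons x l ih =>
    intro k hk
    rcases k with _ | k
    · rcases l with _ | ⟨y, _ | ⟨z, l⟩⟩
      · simp at hk
      · simp at hk
      · have := h.2
        simp only [List.map_cons, List.getD_cons_zero, List.getD_cons_succ, mem_ab_iff, Nat.zero_add]
        simp [ok] at this
        grind
    · have := ih h.1 k (by simp only [List.map_cons, List.length_cons] at hk; omega)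
      simpa only [List.map_cons, Nat.add_right_comm k 1, List.getD_cons_succ] using this

lemma geo_good (l : List Lt) (h : IsGeodesicWord (l.map ev)) (h3 : NoThreeConsecutiveAB (l.map ev)) :
    Good l := by
  induction l with
  | nil => trivial
  | cons x l ih =>
    have hlen := h.2
    rw [List.map_cons, List.prod_cons, List.length_cons] at hlen
    refine ⟨ih ⟨map_letters l, le_antisymm (wl_le _ (map_letters l)) ?_⟩ ?_, ?_⟩
    · obtain ⟨l', h1, h2, h4⟩ := wl_spec _ (map_letters l)
      have := wl_le (ev x :: l') (by
        intro y hy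
        rcases List.mem_cons.1 hy with rfl | hy
        · exact (mem_letters_iff _).2 ⟨x, rfl⟩
        · exact h1 y hy)
      rw [List.prod_cons, h2, List.length_cons] at this
      omega
    · intro k hk
      have := h3 (k + 1) (by simp only [List.map_cons, List.length_cons]; omega)
      simpa only [List.map_cons, Nat.add_right_comm k 1, List.getD_cons_succ] using this
    · have hne : ∀ y l', l = y :: l' → y ≠ flipL x := by
        rintro y l' rfl rfl
        have := wl_le _ (map_letters l')
        rw [List.map_cons, List.prod_cons, ← mul_assoc, ev_flip, one_mul] at hlen
        simp only [List.length_cons, List.length_map] at hlen this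
        omega
      rcases l with _ | ⟨y, _ | ⟨z, l⟩⟩
      · rfl
      · simpa [ok] using hne y _ rfl
      · have h0 := h3 0 (by simp)
        simp only [List.map_cons, List.getD_cons_zero, List.getD_cons_succ, mem_ab_iff,
          Nat.zero_add] at h0
        have := hne y _ rfl
        simp [ok, this]
        grind

/-! ### counting -/

def ty : List Lt → Fin 4
  | [] => 0
  | [x] => if isAB x then 2 else 1
  | x :: y :: _ => if isAB x then (if isAB y then 3 else 2) else 1

def gfs : ℕ → Finset (List Lt)
  | 0 => {[]}
  | n + 1 => ((gfs n ×ˢ (Finset.univ : Finset Lt)).filter (fun p => ok p.2 p.1 = true)).image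
      (fun p => p.2 :: p.1)

lemma mem_gfs (n : ℕ) (l : List Lt) : l ∈ gfs n ↔ Good l ∧ l.length = n := by
  induction n generalizing l with
  | zero =>
    simp only [gfs, Finset.mem_singleton, List.length_eq_zero_iff]
    constructor
    · rintro rfl; exact ⟨trivial, rfl⟩
    · exact fun h => h.2
  | succ n ih =>
    rcases l with _ | ⟨x, l⟩
    · simp [gfs]
    · simp only [gfs, Finset.mem_image, Finset.mem_filter, Finset.mem_product, Finset.mem_univ,
        and_true, List.cons.injEq, ih, Good, List.length_cons, Nat.add_right_cancel_iff]
      constructor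
      · rintro ⟨⟨l', x'⟩, ⟨⟨h1, h2⟩, h3⟩, rfl, rfl⟩
        exact ⟨⟨h1, h3⟩, h2⟩
      · rintro ⟨⟨h1, h3⟩, h2⟩
        exact ⟨(l, x), ⟨⟨h1, h2⟩, h3⟩, rfl, rfl⟩

def cnt (n : ℕ) (j : Fin 4) : ℕ := ((gfs n).filter (fun l => ty l = j)).card

def tr : Fin 4 → Fin 4 → ℕ := ![![0, 2, 4, 0], ![0, 1, 4, 0], ![0, 2, 0, 3], ![0, 2, 0, 0]]

def stepF (l : List Lt) (j : Fin 4) : ℕ :=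
  ((Finset.univ : Finset Lt).filter (fun x => ok x l = true ∧ ty (x :: l) = j)).card

lemma stepF_nil : ∀ j, stepF [] j = tr 0 j := by decide

lemma stepF_one : ∀ y : Lt, ∀ j, stepF [y] j = tr (ty [y]) j := by decide

lemma stepF_two : ∀ y z : Lt, ∀ j, stepF [y, z] j = tr (ty [y, z]) j := by decide

lemma stepF_eq (l : List Lt) (j : Fin 4) : stepF l j = tr (ty l) j := by
  rcases l with _ | ⟨y, _ | ⟨z, l⟩⟩
  · exact stepF_nil j
  · exact stepF_one y j
  · exact stepF_two y z j

lemma cnt_succ (n : ℕ) (j : Fin 4) : cnt (n + 1) j = ∑ i, cnt n i * tr i j := by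
  have h1 : cnt (n + 1) j = ∑ l ∈ gfs n, stepF l j := by
    unfold cnt stepF
    rw [gfs, Finset.filter_image, Finset.card_image_of_injective, Finset.filter_filter,
      Finset.card_filter, Finset.sum_product]
    · simp only [Finset.card_filter]
    · rintro ⟨l, x⟩ ⟨l', x'⟩ h
      simp only [List.cons.injEq] at h
      simp [h.1, h.2]
  rw [h1, ← Finset.sum_fiberwise (gfs n) ty]
  refine Finset.sum_congr rfl fun i _ => ?_
  rw [cnt, Finset.card_eq_sum_ones, Finset.sum_mul]
  refine Finset.sum_congr rfl fun l hl => ?_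
  rw [stepF_eq, (Finset.mem_filter.1 hl).2, one_mul]

lemma card_gfs (n : ℕ) : (gfs n).card = cnt n 0 + cnt n 1 + cnt n 2 + cnt n 3 := by
  have := Finset.card_eq_sum_card_fiberwise (f := ty) (s := gfs n) (t := Finset.univ) (by simp)
  rw [this, Fin.sum_univ_four]
  rfl

lemma ncard_eq (n : ℕ) : Set.ncard
    {w : List Gp | IsGeodesicWord w ∧ NoThreeConsecutiveAB w ∧ w.length = n} = (gfs n).card := by
  have : {w : List Gp | IsGeodesicWord w ∧ NoThreeConsecutiveAB w ∧ w.length = n} =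
      (List.map ev) '' (gfs n : Set (List Lt)) := by
    ext w
    simp only [Set.mem_ofPred_eq, Set.mem_image, Finset.mem_coe, mem_gfs]
    constructor
    · rintro ⟨h1, h2, h3⟩
      obtain ⟨l, rfl⟩ : ∃ l : List Lt, l.map ev = w := by
        have : w ∈ Set.range (List.map ev) := by
          rw [Set.range_list_map]
          exact fun x hx => (mem_letters_iff x).1 (h1.1 x hx)
        exact this
      exact ⟨l, ⟨geo_good l h1 h2, by simpa using h3⟩, rfl⟩
    · rintro ⟨l, ⟨h1, h2⟩, rfl⟩
      exact ⟨good_geodesic l h1, good_noThree l h1, by simpa using h2⟩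
  rw [this, Set.ncard_image_of_injective _ (List.map_injective_iff.2 ev_inj), Set.ncard_coe_finset]

lemma cnt_rec (n : ℕ) : cnt (n + 1) 0 = 0 ∧
    cnt (n + 1) 1 = 2 * cnt n 0 + cnt n 1 + 2 * cnt n 2 + 2 * cnt n 3 ∧
    cnt (n + 1) 2 = 4 * cnt n 0 + 4 * cnt n 1 ∧ cnt (n + 1) 3 = 3 * cnt n 2 := by
  refine ⟨?_, ?_, ?_, ?_⟩ <;> rw [cnt_succ, Fin.sum_univ_four] <;> simp [tr] <;> omega

lemma cnt_zero : cnt 0 0 = 1 ∧ cnt 0 1 = 0 ∧ cnt 0 2 = 0 ∧ cnt 0 3 = 0 := by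
  refine ⟨?_, ?_, ?_, ?_⟩ <;> rfl

end Helpers

/-- the number `k_n` of geodesic words of length `n` over the
six-letter alphabet of `G = ⟨a,b,c ∣ aba⁻¹b⁻¹⟩` containing no three
consecutive letters from `{a, a⁻¹, b, b⁻¹}` satisfies `k₀ = 1`, `k₁ = 6`,
`k₂ = 30`, `k₃ = 114`, and `k_n = k_{n-1} + 8 k_{n-2} + 24 k_{n-3}` for
`n ≥ 4`. -/
theorem geodesic_growth_two_contracting (k : ℕ → ℕ)
    (hk : ∀ n, k n = Set.ncard
      {w : List Gp | IsGeodesicWord w ∧ NoThreeConsecutiveAB w ∧ w.length = n}) :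
    k 0 = 1 ∧ k 1 = 6 ∧ k 2 = 30 ∧ k 3 = 114 ∧
      ∀ n, 4 ≤ n → k n = k (n - 1) + 8 * k (n - 2) + 24 * k (n - 3) := by
  have hk' : ∀ n, k n = cnt n 0 + cnt n 1 + cnt n 2 + cnt n 3 := fun n => by
    rw [hk, ncard_eq, card_gfs]
  have h0 := cnt_zero
  have r0 := cnt_rec 0
  have r1 := cnt_rec 1
  have r2 := cnt_rec 2
  simp only [Nat.zero_add, Nat.reduceAdd] at r0 r1 r2
  refine ⟨?_, ?_, ?_, ?_, ?_⟩
  · rw [hk']; omega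
  · rw [hk']; omega
  · rw [hk']; omega
  · rw [hk']; omega
  · intro n hn
    obtain ⟨m, rfl⟩ : ∃ m, n = m + 4 := ⟨n - 4, by omega⟩
    have e1 : m + 4 - 1 = m + 3 := by omega
    have e2 : m + 4 - 2 = m + 2 := by omega
    have e3 : m + 4 - 3 = m + 1 := by omega
    rw [e1, e2, e3, hk', hk', hk', hk']
    have a0 := cnt_rec m
    have a1 := cnt_rec (m + 1)
    have a2 := cnt_rec (m + 2)
    have a3 := cnt_rec (m + 3)
    simp only [Nat.add_assoc, Nat.reduceAdd] at a1 a2 a3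
    omega
end
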